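/- Let 1 ≤ p₂ ≤ p₁ ≤ ∞. Then for every N ∈ ℕ and every k ∈ ℕ with 1 ≤ k ≤ N one has the exact identity c_k(id : ℓ_{p₁}^N → ℓ_{p₂}^N) = (N − k + 1)^{1/p₂ − 1/p₁} (with the convention 1/∞ = 0). -/

import Mathlib

open scoped ENNReal

/-- The `k`-th Gelfand number of a continuous linear operator `T : X → Y`. -/
noncomputable def gelfandNumber {X Y : Type*} [NormedAddCommGroup X] [NormedSpace ℂ X]
    [NormedAddCommGroup Y] [NormedSpace ℂ Y] (T : X →L[ℂ] Y) (k : ℕ) : ℝ :=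
  sInf { r | ∃ M : Submodule ℂ X, IsClosed (M : Set X) ∧
    Module.rank ℂ (X ⧸ M) < (k : Cardinal) ∧
    r = ⨆ x : {x : M // ‖(x : X)‖ ≤ 1}, ‖T (x : X)‖ }

/-- The identity operator `id : ℓ_{p₁}^N → ℓ_{p₂}^N` on `ℂ^N`. -/
noncomputable def lpId (p₁ p₂ : ℝ≥0∞) [Fact (1 ≤ p₁)] [Fact (1 ≤ p₂)] (N : ℕ) :
    PiLp p₁ (fun _ : Fin N => ℂ) →L[ℂ] PiLp p₂ (fun _ : Fin N => ℂ) :=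
  LinearMap.toContinuousLinearMap
    (((WithLp.linearEquiv p₂ ℂ (Fin N → ℂ)).symm.toLinearMap).comp
      (WithLp.linearEquiv p₁ ℂ (Fin N → ℂ)).toLinearMap)

/-- Comparison of `ℓ_p`-norms of a vector supported in a finite set. -/
theorem norm_toLp_le_card_rpow_mul {ι : Type*} [Fintype ι] {p₁ p₂ : ℝ≥0∞}
    [Fact (1 ≤ p₁)] [Fact (1 ≤ p₂)] (h : p₂ ≤ p₁) (s : Finset ι) (x : ι → ℂ)
    (hx : ∀ i ∉ s, x i = 0) :
    ‖WithLp.toLp p₂ x‖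
      ≤ (s.card : ℝ) ^ ((p₂⁻¹).toReal - (p₁⁻¹).toReal) * ‖WithLp.toLp p₁ x‖ := by
  have hp₂ : 1 ≤ p₂ := Fact.out
  rcases eq_or_ne p₂ ⊤ with rfl | h2
  · obtain rfl : p₁ = ⊤ := top_le_iff.mp h
    simp
  have a2 : 1 ≤ p₂.toReal := by
    simpa using ENNReal.toReal_mono h2 hp₂
  have b2 : 0 < p₂.toReal := by linarith
  have sum_eq : ∀ a : ℝ, 0 < a → ∑ i, ‖x i‖ ^ a = ∑ i ∈ s, ‖x i‖ ^ a := by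
    intro a ha
    refine (Finset.sum_subset (Finset.subset_univ s) fun i _ hi => ?_).symm
    rw [hx i hi, norm_zero, Real.zero_rpow ha.ne']
  have sum_nonneg : ∀ a : ℝ, 0 ≤ ∑ i ∈ s, ‖x i‖ ^ a := fun a =>
    Finset.sum_nonneg fun i _ => Real.rpow_nonneg (norm_nonneg _) _
  have hs : (0 : ℝ) ≤ s.card := Nat.cast_nonneg _
  rw [PiLp.norm_eq_sum b2, ENNReal.toReal_inv, ENNReal.toReal_inv]
  simp only [one_div]
  rw [sum_eq _ b2]
  rcases eq_or_ne p₁ ⊤ with rfl | h1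
  · have hle : ∑ i ∈ s, ‖x i‖ ^ p₂.toReal
        ≤ s.card * ‖WithLp.toLp (⊤ : ℝ≥0∞) x‖ ^ p₂.toReal := by
      rw [← nsmul_eq_mul]
      refine Finset.sum_le_card_nsmul _ _ _ fun i _ => ?_
      exact Real.rpow_le_rpow (norm_nonneg _)
        (PiLp.norm_apply_le (WithLp.toLp (⊤ : ℝ≥0∞) x) i) b2.le
    calc (∑ i ∈ s, ‖x i‖ ^ p₂.toReal) ^ p₂.toReal⁻¹
        ≤ (s.card * ‖WithLp.toLp (⊤ : ℝ≥0∞) x‖ ^ p₂.toReal) ^ p₂.toReal⁻¹ :=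
          Real.rpow_le_rpow (sum_nonneg _) hle (inv_nonneg.mpr b2.le)
      _ = _ := by
          rw [Real.mul_rpow hs (by positivity), Real.rpow_rpow_inv (norm_nonneg _) b2.ne']
          simp
  · have h12 : p₂.toReal ≤ p₁.toReal := ENNReal.toReal_mono h1 h
    have b1 : 0 < p₁.toReal := by linarith
    have key := Real.rpow_sum_le_const_mul_sum_rpow s (fun i => ‖x i‖ ^ p₂.toReal)
      ((one_le_div b2).mpr h12)
    have habs : ∀ i, |‖x i‖ ^ p₂.toReal| = ‖x i‖ ^ p₂.toReal := fun i =>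
      abs_of_nonneg (Real.rpow_nonneg (norm_nonneg _) _)
    have hpow : ∀ i, (‖x i‖ ^ p₂.toReal) ^ (p₁.toReal / p₂.toReal) = ‖x i‖ ^ p₁.toReal := by
      intro i
      rw [← Real.rpow_mul (norm_nonneg _), mul_div_cancel₀ _ b2.ne']
    simp only [habs, hpow] at key
    have key' := Real.rpow_le_rpow (Real.rpow_nonneg (sum_nonneg _) _) key
      (inv_nonneg.mpr b1.le)
    rw [← Real.rpow_mul (sum_nonneg _), Real.mul_rpow (Real.rpow_nonneg hs _) (sum_nonneg _),
      ← Real.rpow_mul hs] at key'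
    rw [PiLp.norm_eq_sum b1]
    simp only [one_div]
    rw [sum_eq _ b1]
    convert key' using 2
    · field_simp
    · congr 1
      field_simp

/-- Comparison of `ℓ_p`-norms of a vector of sup norm at most one with many unimodular
coordinates. -/
theorem rpow_mul_norm_toLp_le {ι : Type*} [Fintype ι] {p₁ p₂ : ℝ≥0∞}
    [Fact (1 ≤ p₁)] [Fact (1 ≤ p₂)] (h : p₂ ≤ p₁) {m : ℕ} (hm : 1 ≤ m) (x : ι → ℂ)
    (hx : ∀ i, ‖x i‖ ≤ 1) (s : Finset ι) (hs : ∀ i ∈ s, ‖x i‖ = 1) (hms : m ≤ s.card) :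
    (m : ℝ) ^ ((p₂⁻¹).toReal - (p₁⁻¹).toReal) * ‖WithLp.toLp p₁ x‖ ≤ ‖WithLp.toLp p₂ x‖ := by
  have hp₂ : 1 ≤ p₂ := Fact.out
  rcases eq_or_ne p₂ ⊤ with rfl | h2
  · obtain rfl : p₁ = ⊤ := top_le_iff.mp h
    simp
  have a2 : 1 ≤ p₂.toReal := by
    simpa using ENNReal.toReal_mono h2 hp₂
  have b2 : 0 < p₂.toReal := by linarith
  have m_pos : (0 : ℝ) < m := by exact_mod_cast hm
  have m_le : ∀ a : ℝ, (m : ℝ) ≤ ∑ i, ‖x i‖ ^ a := by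
    intro a
    calc (m : ℝ) ≤ s.card := by exact_mod_cast hms
      _ = ∑ i ∈ s, ‖x i‖ ^ a := by
        rw [Finset.sum_congr rfl fun i hi => by rw [hs i hi, Real.one_rpow]]
        simp
      _ ≤ _ := Finset.sum_le_sum_of_subset_of_nonneg (Finset.subset_univ s)
        fun i _ _ => Real.rpow_nonneg (norm_nonneg _) _
  rw [PiLp.norm_eq_sum b2, ENNReal.toReal_inv, ENNReal.toReal_inv]
  simp only [one_div]
  rcases eq_or_ne p₁ ⊤ with rfl | h1
  · have hle : ‖WithLp.toLp (⊤ : ℝ≥0∞) x‖ ≤ 1 := by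
      rw [PiLp.norm_toLp]
      exact (pi_norm_le_iff_of_nonneg zero_le_one).mpr hx
    calc _ ≤ (m : ℝ) ^ (p₂.toReal⁻¹ - (⊤ : ℝ≥0∞).toReal⁻¹) * 1 := by gcongr
      _ = (m : ℝ) ^ p₂.toReal⁻¹ := by simp
      _ ≤ _ := Real.rpow_le_rpow m_pos.le (m_le _) (inv_nonneg.mpr b2.le)
  · have h12 : p₂.toReal ≤ p₁.toReal := ENNReal.toReal_mono h1 h
    have b1 : 0 < p₁.toReal := by linarith
    rw [PiLp.norm_eq_sum b1]
    simp only [one_div]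
    have S_pos : 0 < ∑ i, ‖x i‖ ^ p₁.toReal := m_pos.trans_le (m_le _)
    calc _ ≤ (∑ i, ‖x i‖ ^ p₁.toReal) ^ (p₂.toReal⁻¹ - p₁.toReal⁻¹)
            * (∑ i, ‖x i‖ ^ p₁.toReal) ^ p₁.toReal⁻¹ := by
          gcongr
          · exact sub_nonneg.mpr (inv_anti₀ b2 h12)
          · exact m_le _
      _ = (∑ i, ‖x i‖ ^ p₁.toReal) ^ p₂.toReal⁻¹ := by
          rw [← Real.rpow_add S_pos, sub_add_cancel]
      _ ≤ _ := by
          refine Real.rpow_le_rpow S_pos.le (Finset.sum_le_sum fun i _ => ?_)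
            (inv_nonneg.mpr b2.le)
          exact Real.rpow_le_rpow_of_exponent_ge_of_imp (norm_nonneg _) (hx i) h12
            fun _ h0 => absurd h0 b1.ne'

/-- A subspace of dimension larger than `s.card` contains a nonzero vector vanishing on `s`. -/
theorem exists_ne_zero_mem_vanishing {ι : Type*} [Fintype ι] (M : Submodule ℂ (ι → ℂ))
    (s : Finset ι) (hs : s.card < Module.finrank ℂ M) :
    ∃ y ∈ M, y ≠ 0 ∧ ∀ i ∈ s, y i = 0 := by
  let f : M →ₗ[ℂ] (s → ℂ) := (LinearMap.funLeft ℂ ℂ ((↑) : s → ι)).comp M.subtype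
  have hf : LinearMap.ker f ≠ ⊥ := by
    refine LinearMap.ker_ne_bot_of_finrank_lt ?_
    simpa using hs
  obtain ⟨y, hy, hy0⟩ := (Submodule.ne_bot_iff _).mp hf
  refine ⟨y, y.2, by simpa using hy0, fun i hi => ?_⟩
  exact congrFun (LinearMap.mem_ker.mp hy) ⟨i, hi⟩

/-- An `m`-dimensional subspace of `ℂ^ι` contains a vector of sup norm at most one with at
least `m` unimodular coordinates. -/
theorem exists_mem_many_unimodular {ι : Type*} [Fintype ι] (M : Submodule ℂ (ι → ℂ))
    (m : ℕ) (hm : m ≤ Module.finrank ℂ M) :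
    ∃ x ∈ M, (∀ i, ‖x i‖ ≤ 1) ∧
      ∃ s : Finset ι, (∀ i ∈ s, ‖x i‖ = 1) ∧ m ≤ s.card := by
  classical
  induction m with
  | zero => exact ⟨0, M.zero_mem, by simp, ∅, by simp, by simp⟩
  | succ m ih =>
    obtain ⟨x, hxM, hx, s', hs', hcard⟩ := ih (by omega)
    let s : Finset ι := {i | ‖x i‖ = 1}
    have hsub : s' ⊆ s := fun i hi => by simpa [s] using hs' i hi
    have hsc : m ≤ s.card := hcard.trans (Finset.card_le_card hsub)
    by_cases hlt : m + 1 ≤ s.card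
    · exact ⟨x, hxM, hx, s, by simp [s], hlt⟩
    obtain ⟨y, hyM, hy0, hys⟩ := exists_ne_zero_mem_vanishing M s (by omega)
    let z : ι → ℂ := fun i => if i ∈ s then 0 else x i
    let g : ℝ → ℝ := fun t => ‖z + (t : ℂ) • y‖
    have hg : Continuous g := by fun_prop
    have hg0 : g 0 ≤ 1 := by
      simp only [g, Complex.ofReal_zero, zero_smul, add_zero]
      refine (pi_norm_le_iff_of_nonneg zero_le_one).mpr fun i => ?_
      by_cases hi : i ∈ s <;> simp [z, hi, hx i]
    have hy_pos : 0 < ‖y‖ := norm_pos_iff.mpr hy0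
    have hT : 0 ≤ (1 + ‖z‖) / ‖y‖ := by positivity
    have hgT : 1 ≤ g ((1 + ‖z‖) / ‖y‖) := by
      have h1 : ‖(((1 + ‖z‖) / ‖y‖ : ℝ) : ℂ) • y‖ = 1 + ‖z‖ := by
        rw [norm_smul, Complex.norm_real, Real.norm_of_nonneg hT, div_mul_cancel₀ _ hy_pos.ne']
      have h2 := norm_sub_le (z + (((1 + ‖z‖) / ‖y‖ : ℝ) : ℂ) • y) z
      rw [add_sub_cancel_left, h1] at h2
      simp only [g]
      linarith
    obtain ⟨t, -, ht⟩ := intermediate_value_Icc hT hg.continuousOn ⟨hg0, hgT⟩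
    have hle : ∀ i, ‖z i + t * y i‖ ≤ 1 := fun i => by
      have := norm_le_pi_norm (z + (t : ℂ) • y) i
      rw [show ‖z + (t : ℂ) • y‖ = 1 from ht] at this
      simpa using this
    obtain ⟨j, hj⟩ : ∃ j, ‖z j + t * y j‖ = 1 := by
      by_contra! hne
      have : ‖z + (t : ℂ) • y‖ < 1 :=
        (pi_norm_lt_iff zero_lt_one).mpr fun i => lt_of_le_of_ne (hle i) (hne i)
      exact this.ne ht
    have hjs : j ∉ s := fun hjs => by simp [z, hjs, hys j hjs] at hj
    have hin : ∀ i ∈ s, (x + (t : ℂ) • y) i = x i := fun i hi => by simp [hys i hi]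
    have hout : ∀ i ∉ s, (x + (t : ℂ) • y) i = z i + t * y i := fun i hi => by simp [z, hi]
    refine ⟨x + (t : ℂ) • y, M.add_mem hxM (M.smul_mem _ hyM), fun i => ?_,
      insert j s, fun i hi => ?_, ?_⟩
    · by_cases hi : i ∈ s
      · rw [hin i hi]; exact hx i
      · rw [hout i hi]; exact hle i
    · rcases Finset.mem_insert.mp hi with rfl | hi
      · rw [hout _ hjs]; exact hj
      · rw [hin i hi]; simpa [s] using hi
    · rw [Finset.card_insert_of_notMem hjs]; omega

/-- On every subspace of codimension less than `k`, the norm of `id : ℓ_{p₁}^N → ℓ_{p₂}^N` is at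
least `(N - k + 1)^{1/p₂ - 1/p₁}`. -/
theorem rpow_le_iSup_norm_lpId {p₁ p₂ : ℝ≥0∞} [Fact (1 ≤ p₁)] [Fact (1 ≤ p₂)] (h : p₂ ≤ p₁)
    {N k : ℕ} (hkN : k ≤ N) (M : Submodule ℂ (PiLp p₁ (fun _ : Fin N => ℂ)))
    (hM : Module.rank ℂ (PiLp p₁ (fun _ : Fin N => ℂ) ⧸ M) < (k : Cardinal)) :
    ((N - k + 1 : ℕ) : ℝ) ^ ((p₂⁻¹).toReal - (p₁⁻¹).toReal)
      ≤ ⨆ x : {x : M // ‖(x : PiLp p₁ (fun _ : Fin N => ℂ))‖ ≤ 1}, ‖lpId p₁ p₂ N (x : M)‖ := by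
  let e := WithLp.linearEquiv p₁ ℂ (Fin N → ℂ)
  have hquot : Module.finrank ℂ (PiLp p₁ (fun _ : Fin N => ℂ) ⧸ M) < k := by
    rw [← Module.finrank_eq_rank] at hM
    exact_mod_cast hM
  have hsum := M.finrank_quotient_add_finrank
  have hN : Module.finrank ℂ (PiLp p₁ (fun _ : Fin N => ℂ)) = N := by
    rw [e.finrank_eq]; simp
  have hmap : Module.finrank ℂ (M.map e.toLinearMap) = Module.finrank ℂ M :=
    LinearEquiv.finrank_map_eq e M
  obtain ⟨x, hxM, hx, s, hs, hcard⟩ :=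
    exists_mem_many_unimodular (M.map e.toLinearMap) (N - k + 1) (by omega)
  obtain ⟨y, hyM, rfl⟩ := hxM
  have hineq := rpow_mul_norm_toLp_le h (by omega) (e y) hx s hs hcard
  have hy1 : WithLp.toLp p₁ (e y) = y := rfl
  have hy2 : WithLp.toLp p₂ (e y) = lpId p₁ p₂ N y := rfl
  rw [hy1, hy2] at hineq
  have hy0 : 0 < ‖y‖ := by
    obtain ⟨i, hi⟩ := Finset.card_pos.mp (show 0 < s.card by omega)
    refine norm_pos_iff.mpr fun h0 => ?_
    have := hs i hi
    simp [h0] at this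
  have hunit : ‖((‖y‖⁻¹ : ℝ) : ℂ) • y‖ = 1 := by
    rw [norm_smul, Complex.norm_real, norm_inv, norm_norm, inv_mul_cancel₀ hy0.ne']
  have hbdd : BddAbove (Set.range fun x : {x : M // ‖(x : PiLp p₁ (fun _ : Fin N => ℂ))‖ ≤ 1} =>
      ‖lpId p₁ p₂ N (x : M)‖) := by
    refine ⟨‖lpId p₁ p₂ N‖, ?_⟩
    rintro _ ⟨x, rfl⟩
    exact (lpId p₁ p₂ N).unit_le_opNorm _ x.2
  refine le_trans ?_ (le_ciSup hbdd ⟨⟨((‖y‖⁻¹ : ℝ) : ℂ) • y, M.smul_mem _ hyM⟩, hunit.le⟩)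
  simp only [map_smul]
  rw [norm_smul, Complex.norm_real, norm_inv, norm_norm, inv_mul_eq_div, le_div_iff₀ hy0]
  exact hineq

/-- The coordinate subspace of vectors vanishing on `s` has codimension at most `s.card`. -/
theorem finrank_quotient_ker_funLeft_le {p : ℝ≥0∞} {ι : Type*} [Fintype ι] (s : Finset ι) :
    Module.finrank ℂ (PiLp p (fun _ : ι => ℂ) ⧸ LinearMap.ker
      ((LinearMap.funLeft ℂ ℂ ((↑) : s → ι)).comp
        (WithLp.linearEquiv p ℂ (ι → ℂ)).toLinearMap)) ≤ s.card := by
  rw [(LinearMap.quotKerEquivRange _).finrank_eq]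
  refine (Submodule.finrank_le _).trans ?_
  simp

/-- If `1 ≤ p₂ ≤ p₁ ≤ ∞` and `1 ≤ k ≤ N`, then
`c_k(id : ℓ_{p₁}^N → ℓ_{p₂}^N) = (N - k + 1)^{1/p₂ - 1/p₁}` (with `1/∞ = 0`). -/
theorem stmt14 (p₁ p₂ : ℝ≥0∞) [Fact (1 ≤ p₁)] [Fact (1 ≤ p₂)] (h : p₂ ≤ p₁)
    (N k : ℕ) (hk : 1 ≤ k) (hkN : k ≤ N) :
    gelfandNumber (lpId p₁ p₂ N) k
      = ((N : ℝ) - (k : ℝ) + 1) ^ ((p₂⁻¹).toReal - (p₁⁻¹).toReal) := by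
  have hcast : (N : ℝ) - (k : ℝ) + 1 = ((N - k + 1 : ℕ) : ℝ) := by
    push_cast [hkN]; ring
  rw [hcast]
  obtain ⟨s, -, hs⟩ := Finset.exists_subset_card_eq
    (show k - 1 ≤ (Finset.univ : Finset (Fin N)).card by simp; omega)
  let M : Submodule ℂ (PiLp p₁ (fun _ : Fin N => ℂ)) := LinearMap.ker
    ((LinearMap.funLeft ℂ ℂ ((↑) : s → Fin N)).comp
      (WithLp.linearEquiv p₁ ℂ (Fin N → ℂ)).toLinearMap)
  have hM : Module.rank ℂ (PiLp p₁ (fun _ : Fin N => ℂ) ⧸ M) < (k : Cardinal) := by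
    have := finrank_quotient_ker_funLeft_le (p := p₁) s
    rw [← Module.finrank_eq_rank]
    have hlt : Module.finrank ℂ (PiLp p₁ (fun _ : Fin N => ℂ) ⧸ M) < k := by
      simp only [M]; omega
    exact_mod_cast hlt
  have hMclosed : IsClosed (M : Set (PiLp p₁ (fun _ : Fin N => ℂ))) :=
    M.closed_of_finiteDimensional
  unfold gelfandNumber
  refine le_antisymm ?_ (le_csInf ⟨_, M, hMclosed, hM, rfl⟩ ?_)
  · refine le_trans (csInf_le ⟨0, ?_⟩ ⟨M, hMclosed, hM, rfl⟩) ?_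
    · rintro _ ⟨_, -, -, rfl⟩
      exact Real.iSup_nonneg fun _ => norm_nonneg _
    · have : Nonempty {x : M // ‖(x : PiLp p₁ (fun _ : Fin N => ℂ))‖ ≤ 1} := ⟨⟨0, by simp⟩⟩
      refine ciSup_le fun ⟨⟨x, hxM⟩, hx⟩ => ?_
      have hcard : sᶜ.card = N - k + 1 := by
        rw [Finset.card_compl, hs, Fintype.card_fin]; omega
      have hvan : ∀ i ∉ sᶜ, x.ofLp i = 0 := fun i hi =>
        congrFun (LinearMap.mem_ker.mp hxM) ⟨i, by simpa using hi⟩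
      have hle := norm_toLp_le_card_rpow_mul h sᶜ x.ofLp hvan
      rw [hcard] at hle
      exact hle.trans (mul_le_of_le_one_right (by positivity) hx)
  · rintro _ ⟨M', -, hM', rfl⟩
    exact rpow_le_iSup_norm_lpId h hkN M' hM'
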